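/- Let X_1, …, X_N (N ≥ 3) be random variables taking finitely many values and define the N-partite dependence D_N(X) = min over ordered pairs of distinct indices i ≠ j of I(X_i : X_j | (X_k)_{k∉{i,j}}). Let U_1, …, U_N be random variables such that U_1, …, U_N and the tuple (X_1,…,X_N) are mutually independent, and set X̄_i = f_i(X_i, U_i) for arbitrary functions f_i. Suppose the pair (1,2) attains the minimum defining D_N(X). Then D_N(X̄) ≤ D_N(X) + I((X_1,X_2) : (X_3,…,X_N)) − I((X_1,X_2) : (X̄_3,…,X̄_N)). -/

import Mathlib

/-- Probability that the random variable `X` (on the finite sample space `Ω`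
with probability mass function `p`) takes the value `s`. -/
noncomputable def pOf {Ω S : Type*} [Fintype Ω] [DecidableEq S]
    (p : Ω → ℝ) (X : Ω → S) (s : S) : ℝ :=
  ∑ ω, if X ω = s then p ω else 0

/-- Shannon entropy (natural logarithm, `0 log 0 = 0`) of a random variable `X`. -/
noncomputable def ent {Ω S : Type*} [Fintype Ω] [Fintype S] [DecidableEq S]
    (p : Ω → ℝ) (X : Ω → S) : ℝ :=
  ∑ s, Real.negMulLog (pOf p X s)

/-- Mutual information `I(X : Y) = H(X) + H(Y) - H(X,Y)`. -/
noncomputable def mi {Ω S T : Type*} [Fintype Ω] [Fintype S] [DecidableEq S]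
    [Fintype T] [DecidableEq T] (p : Ω → ℝ) (X : Ω → S) (Y : Ω → T) : ℝ :=
  ent p X + ent p Y - ent p (fun ω => (X ω, Y ω))

/-- Conditional mutual information
`I(X : Y | Z) = H(X,Z) + H(Y,Z) - H(X,Y,Z) - H(Z)`. -/
noncomputable def cmi {Ω S T U : Type*} [Fintype Ω] [Fintype S] [DecidableEq S]
    [Fintype T] [DecidableEq T] [Fintype U] [DecidableEq U]
    (p : Ω → ℝ) (X : Ω → S) (Y : Ω → T) (Z : Ω → U) : ℝ :=
  ent p (fun ω => (X ω, Z ω)) + ent p (fun ω => (Y ω, Z ω))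
    - ent p (fun ω => ((X ω, Y ω), Z ω)) - ent p Z

/-- `N`-partite dependence: the minimum, over ordered pairs of distinct indices
`i ≠ j`, of `I(X_i : X_j | (X_k)_{k ∉ {i,j}})` (as an infimum of the finite
nonempty set of such values). -/
noncomputable def depC {Ω : Type*} [Fintype Ω] {n : ℕ} {V : Fin n → Type*}
    [∀ i, Fintype (V i)] [∀ i, DecidableEq (V i)]
    (p : Ω → ℝ) (X : (i : Fin n) → Ω → V i) : ℝ :=
  sInf {x | ∃ i j : Fin n, i ≠ j ∧
    x = cmi p (X i) (X j) (fun ω => fun k : {k : Fin n // k ≠ i ∧ k ≠ j} => X k ω)}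

theorem pOf_nonneg' {Ω S : Type*} [Fintype Ω] [DecidableEq S]
    (p : Ω → ℝ) (hp : ∀ ω, 0 ≤ p ω) (X : Ω → S) (s : S) : 0 ≤ pOf p X s := by
  unfold pOf
  apply Finset.sum_nonneg
  intro ω _
  split_ifs
  · exact hp ω
  · exact le_rfl

theorem sum_pOf_mul {Ω S : Type*} [Fintype Ω] [Fintype S] [DecidableEq S]
    (p : Ω → ℝ) (X : Ω → S) (g : S → ℝ) :
    ∑ s, pOf p X s * g s = ∑ ω, p ω * g (X ω) := by
  unfold pOf
  simp_rw [Finset.sum_mul]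
  rw [Finset.sum_comm]
  apply Finset.sum_congr rfl
  intro ω _
  simp [ite_mul]

theorem sum_pOf {Ω S : Type*} [Fintype Ω] [Fintype S] [DecidableEq S]
    (p : Ω → ℝ) (X : Ω → S) : ∑ s, pOf p X s = ∑ ω, p ω := by
  simpa using sum_pOf_mul p X (fun _ => 1)

theorem ent_eq {Ω S : Type*} [Fintype Ω] [Fintype S] [DecidableEq S]
    (p : Ω → ℝ) (X : Ω → S) :
    ent p X = - ∑ ω, p ω * Real.log (pOf p X (X ω)) := by
  rw [← sum_pOf_mul p X (fun s => Real.log (pOf p X s)), ← Finset.sum_neg_distrib]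
  unfold ent
  apply Finset.sum_congr rfl
  intro s _
  simp [Real.negMulLog]

theorem ent_congr {Ω S T : Type*} [Fintype Ω] [Fintype S] [DecidableEq S]
    [Fintype T] [DecidableEq T] (p : Ω → ℝ) (Y : Ω → S) (W : Ω → T)
    (h : ∀ ω ω', Y ω = Y ω' ↔ W ω = W ω') : ent p Y = ent p W := by
  rw [ent_eq, ent_eq]
  have : ∀ ω, pOf p Y (Y ω) = pOf p W (W ω) := by
    intro ω
    unfold pOf
    apply Finset.sum_congr rfl
    intro ω' _
    simp only [h ω' ω]
  simp_rw [this]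

theorem le_pOf {Ω S : Type*} [Fintype Ω] [DecidableEq S]
    (p : Ω → ℝ) (hp : ∀ ω, 0 ≤ p ω) (X : Ω → S) (ω : Ω) : p ω ≤ pOf p X (X ω) := by
  unfold pOf
  have := Finset.single_le_sum (f := fun ω' => if X ω' = X ω then p ω' else 0)
    (s := Finset.univ) (a := ω) (fun i _ => by split_ifs <;> simp [hp]) (Finset.mem_univ _)
  simpa using this

/-- Marginalisation. -/
theorem sum_pOf_pair {Ω S T : Type*} [Fintype Ω] [Fintype S] [DecidableEq S]
    [DecidableEq T] (p : Ω → ℝ) (X : Ω → S) (Z : Ω → T) (z : T) :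
    ∑ s, pOf p (fun ω => (X ω, Z ω)) (s, z) = pOf p Z z := by
  unfold pOf
  rw [Finset.sum_comm]
  apply Finset.sum_congr rfl
  intro ω _
  by_cases h : Z ω = z <;> simp [h]

theorem sum_pOf_pair_right {Ω S T : Type*} [Fintype Ω] [DecidableEq S]
    [Fintype T] [DecidableEq T] (p : Ω → ℝ) (X : Ω → S) (Z : Ω → T) (s : S) :
    ∑ z, pOf p (fun ω => (X ω, Z ω)) (s, z) = pOf p X s := by
  unfold pOf
  rw [Finset.sum_comm]
  apply Finset.sum_congr rfl
  intro ω _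
  by_cases h : X ω = s <;> simp [h]

theorem cmi_nonneg' {Ω S T U : Type*} [Fintype Ω] [Fintype S] [DecidableEq S]
    [Fintype T] [DecidableEq T] [Fintype U] [DecidableEq U]
    (p : Ω → ℝ) (hp : ∀ ω, 0 ≤ p ω)
    (X : Ω → S) (Y : Ω → T) (Z : Ω → U) : 0 ≤ cmi p X Y Z := by
  unfold cmi
  rw [ent_eq, ent_eq, ent_eq, ent_eq]
  set a : S × U → ℝ := pOf p (fun ω => (X ω, Z ω)) with ha
  set b : T × U → ℝ := pOf p (fun ω => (Y ω, Z ω)) with hb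
  set c : (S × T) × U → ℝ := pOf p (fun ω => ((X ω, Y ω), Z ω)) with hc
  set d : U → ℝ := pOf p Z with hd
  have ha0 : ∀ s, 0 ≤ a s := pOf_nonneg' p hp _
  have hb0 : ∀ s, 0 ≤ b s := pOf_nonneg' p hp _
  have hc0 : ∀ s, 0 ≤ c s := pOf_nonneg' p hp _
  have hd0 : ∀ s, 0 ≤ d s := pOf_nonneg' p hp _
  let q : (S × T) × U → ℝ := fun t => a (t.1.1, t.2) * b (t.1.2, t.2) / (d t.2 * c t)
  have key : ∀ ω, p ω * Real.log (a (X ω, Z ω)) + p ω * Real.log (b (Y ω, Z ω))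
      - p ω * Real.log (c ((X ω, Y ω), Z ω)) - p ω * Real.log (d (Z ω))
      ≤ p ω * q ((X ω, Y ω), Z ω) - p ω := by
    intro ω
    rcases (hp ω).eq_or_lt with h | h
    · simp [← h]
    · have h1 : 0 < a (X ω, Z ω) := h.trans_le (le_pOf p hp (fun ω => (X ω, Z ω)) ω)
      have h2 : 0 < b (Y ω, Z ω) := h.trans_le (le_pOf p hp (fun ω => (Y ω, Z ω)) ω)
      have h3 : 0 < c ((X ω, Y ω), Z ω) :=
        h.trans_le (le_pOf p hp (fun ω => ((X ω, Y ω), Z ω)) ω)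
      have h4 : 0 < d (Z ω) := h.trans_le (le_pOf p hp Z ω)
      have h5 : 0 < q ((X ω, Y ω), Z ω) := by
        simp only [q]; positivity
      have h6 := Real.log_le_sub_one_of_pos h5
      have h7 : Real.log (q ((X ω, Y ω), Z ω)) = Real.log (a (X ω, Z ω))
          + Real.log (b (Y ω, Z ω)) - (Real.log (d (Z ω)) + Real.log (c ((X ω, Y ω), Z ω))) := by
        simp only [q]
        rw [Real.log_div (by positivity) (by positivity), Real.log_mul h1.ne' h2.ne',
          Real.log_mul h4.ne' h3.ne']
      rw [h7] at h6
      have := mul_le_mul_of_nonneg_left h6 h.le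
      linarith
  have hsum := Finset.sum_le_sum (fun ω (_ : ω ∈ Finset.univ) => key ω)
  simp only [Finset.sum_sub_distrib, Finset.sum_add_distrib] at hsum
  have hq : ∑ ω, p ω * q ((X ω, Y ω), Z ω) ≤ ∑ ω, p ω := by
    rw [← sum_pOf_mul p (fun ω => ((X ω, Y ω), Z ω)) q]
    calc ∑ s, c s * q s ≤ ∑ s : (S × T) × U, a (s.1.1, s.2) * b (s.1.2, s.2) / d s.2 := by
          apply Finset.sum_le_sum
          intro s _
          rcases (hc0 s).eq_or_lt with h | h
          · rw [← h, zero_mul]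
            exact div_nonneg (mul_nonneg (ha0 _) (hb0 _)) (hd0 _)
          · apply le_of_eq
            simp only [q]
            rcases (hd0 s.2).eq_or_lt with h' | h'
            · simp [← h']
            · field_simp
      _ = ∑ z, d z := by
          rw [Fintype.sum_prod_type_right]
          apply Finset.sum_congr rfl
          intro z _
          rw [Fintype.sum_prod_type]
          simp only
          simp_rw [← Finset.sum_div, ← Finset.mul_sum, ← Finset.sum_mul]
          rw [ha, hb, sum_pOf_pair, sum_pOf_pair, ← hd]
          rcases (hd0 z).eq_or_lt with h' | h'
          · simp [← h']
          · field_simp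
      _ = ∑ ω, p ω := sum_pOf p Z
  linarith

/-- Submodularity of entropy. -/
theorem submod {Ω S T R J : Type*} [Fintype Ω] [Fintype S] [DecidableEq S]
    [Fintype T] [DecidableEq T] [Fintype R] [DecidableEq R] [Fintype J] [DecidableEq J]
    (p : Ω → ℝ) (hp : ∀ ω, 0 ≤ p ω)
    (X : Ω → S) (Y : Ω → T) (K : Ω → J) (Z : Ω → R)
    (h1 : ∀ ω ω', X ω = X ω' → Z ω = Z ω') (h2 : ∀ ω ω', Y ω = Y ω' → Z ω = Z ω')
    (h3 : ∀ ω ω', K ω = K ω' ↔ X ω = X ω' ∧ Y ω = Y ω') :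
    ent p K + ent p Z ≤ ent p X + ent p Y := by
  have h := cmi_nonneg' p hp X Y Z
  unfold cmi at h
  rw [ent_congr p (fun ω => (X ω, Z ω)) X (by
      intro ω ω'; simp only [Prod.mk.injEq]; exact ⟨fun h => h.1, fun h => ⟨h, h1 _ _ h⟩⟩),
    ent_congr p (fun ω => (Y ω, Z ω)) Y (by
      intro ω ω'; simp only [Prod.mk.injEq]; exact ⟨fun h => h.1, fun h => ⟨h, h2 _ _ h⟩⟩),
    ent_congr p (fun ω => ((X ω, Y ω), Z ω)) K (by
      intro ω ω'; simp only [Prod.mk.injEq]; rw [h3]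
      exact ⟨fun h => h.1, fun h => ⟨h, h1 _ _ h.1⟩⟩)] at h
  linarith

/-- The joint law of `(Y, Z)` factorises. -/
def Fac {Ω S T : Type*} [Fintype Ω] [DecidableEq S] [DecidableEq T]
    (p : Ω → ℝ) (Y : Ω → S) (Z : Ω → T) : Prop :=
  ∃ (a : S → ℝ) (b : T → ℝ), ∀ s t, pOf p (fun ω => (Y ω, Z ω)) (s, t) = a s * b t

theorem pOf_comp {Ω S T : Type*} [Fintype Ω] [Fintype S] [DecidableEq S] [DecidableEq T]
    (p : Ω → ℝ) (X : Ω → S) (g : S → T) (t : T) :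
    pOf p (fun ω => g (X ω)) t = ∑ s, if g s = t then pOf p X s else 0 := by
  have := sum_pOf_mul p X (fun s => if g s = t then 1 else 0)
  simp only [mul_ite, mul_one, mul_zero] at this
  rw [this]
  rfl

theorem Fac.map {Ω S T T' : Type*} [Fintype Ω] [Fintype S] [DecidableEq S]
    [Fintype T] [DecidableEq T] [DecidableEq T']
    {p : Ω → ℝ} {Y : Ω → S} {Z : Ω → T} (h : Fac p Y Z) (g : T → T') :
    Fac p Y (fun ω => g (Z ω)) := by
  obtain ⟨a, b, hab⟩ := h
  refine ⟨a, fun t' => ∑ t, if g t = t' then b t else 0, fun s t' => ?_⟩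
  have h := pOf_comp p (fun ω => (Y ω, Z ω)) (fun x => (x.1, g x.2)) (s, t')
  simp only at h
  rw [h, Fintype.sum_prod_type, Finset.mul_sum, Finset.sum_comm]
  apply Finset.sum_congr rfl
  intro t _
  by_cases ht : g t = t' <;> simp [ht, hab]

theorem Fac.ent_add {Ω S T : Type*} [Fintype Ω] [Fintype S] [DecidableEq S]
    [Fintype T] [DecidableEq T]
    {p : Ω → ℝ} (hp1 : ∑ ω, p ω = 1) {Y : Ω → S} {Z : Ω → T}
    (h : Fac p Y Z) : ent p (fun ω => (Y ω, Z ω)) = ent p Y + ent p Z := by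
  obtain ⟨a, b, hab⟩ := h
  have hY : ∀ s, pOf p Y s = a s * ∑ t, b t := fun s => by
    rw [← sum_pOf_pair_right p Y Z s, Finset.mul_sum]
    exact Finset.sum_congr rfl fun t _ => hab s t
  have hZ : ∀ t, pOf p Z t = (∑ s, a s) * b t := fun t => by
    rw [← sum_pOf_pair p Y Z t, Finset.sum_mul]
    exact Finset.sum_congr rfl fun s _ => hab s t
  have h1 : (∑ s, a s) * ∑ t, b t = 1 := by
    rw [← hp1, ← sum_pOf p Y, Finset.sum_mul]
    exact Finset.sum_congr rfl fun s _ => (hY s).symm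
  have hi : ∀ s t, pOf p (fun ω => (Y ω, Z ω)) (s, t) = pOf p Y s * pOf p Z t := by
    intro s t
    rw [hab, hY, hZ]
    linear_combination (-(a s * b t)) * h1
  unfold ent
  rw [Fintype.sum_prod_type]
  simp_rw [hi, Real.negMulLog_mul, Finset.sum_add_distrib, ← Finset.mul_sum, ← Finset.sum_mul]
  simp only [sum_pOf, hp1, one_mul]

theorem fac_one {n : ℕ} {Ω : Type*} [Fintype Ω]
    {V W : Fin n → Type*}
    [∀ i, Fintype (V i)] [∀ i, DecidableEq (V i)]
    [∀ i, Fintype (W i)] [∀ i, DecidableEq (W i)]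
    (p : Ω → ℝ)
    (X : (i : Fin n) → Ω → V i) (U : (i : Fin n) → Ω → W i)
    (hind : ∀ (u : (i : Fin n) → W i) (x : (i : Fin n) → V i),
      pOf p (fun ω => ((fun i => U i ω), (fun i => X i ω))) (u, x)
        = (∏ i, pOf p (U i) (u i)) * pOf p (fun ω => fun i => X i ω) x) (i : Fin n) :
    Fac p (U i) (fun ω => ((fun k => X k ω), (fun k : {k : Fin n // k ≠ i} => U k ω))) := by
  refine ⟨pOf p (U i), fun t => (∏ k : {k : Fin n // k ≠ i}, pOf p (U k) (t.2 k)) *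
    pOf p (fun ω => fun i => X i ω) t.1, ?_⟩
  rintro s ⟨x, v⟩
  let u : (i : Fin n) → W i := (Equiv.piSplitAt i W).symm (s, v)
  have hus : u i = s := by simp [u, Equiv.piSplitAt]
  have huv : ∀ k : {k : Fin n // k ≠ i}, u k = v k := by
    intro k; simp [u, Equiv.piSplitAt, k.2]
  have h := hind u x
  rw [Fintype.prod_eq_mul_prod_subtype_ne _ i] at h
  simp only [hus, huv] at h
  rw [← mul_assoc, ← h]
  unfold pOf
  apply Finset.sum_congr rfl
  intro ω _
  congr 1
  simp only [Prod.mk.injEq, eq_iff_iff]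
  constructor
  · rintro ⟨h1, h2, h3⟩
    refine ⟨?_, h2⟩
    funext k
    by_cases hk : k = i
    · subst hk; rw [hus, h1]
    · rw [huv ⟨k, hk⟩, ← h3]
  · rintro ⟨h1, h2⟩
    refine ⟨by rw [← hus, ← h1], h2, ?_⟩
    funext k
    rw [← huv k, ← h1]

set_option synthInstance.maxHeartbeats 400000
set_option synthInstance.maxSize 4000

/-- bound on the increase of the `N`-partite dependence under local
stochastic operations `X̄_i = f_i(X_i, U_i)`, when the pair `(1,2)` (here indices
`0`, `1` of `Fin (N+3)`) attains the minimum defining `D_N(X)`: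
`D_N(X̄) ≤ D_N(X) + I((X_1,X_2) : (X_3,…,X_N)) − I((X_1,X_2) : (X̄_3,…,X̄_N))`. -/
theorem stmt_3 {N : ℕ} {Ω : Type*} [Fintype Ω]
    {V W V' : Fin (N + 3) → Type*}
    [∀ i, Fintype (V i)] [∀ i, DecidableEq (V i)]
    [∀ i, Fintype (W i)] [∀ i, DecidableEq (W i)]
    [∀ i, Fintype (V' i)] [∀ i, DecidableEq (V' i)]
    (p : Ω → ℝ) (hp : ∀ ω, 0 ≤ p ω) (hp1 : ∑ ω, p ω = 1)
    (X : (i : Fin (N + 3)) → Ω → V i) (U : (i : Fin (N + 3)) → Ω → W i)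
    (f : (i : Fin (N + 3)) → V i → W i → V' i)
    (hind : ∀ (u : (i : Fin (N + 3)) → W i) (x : (i : Fin (N + 3)) → V i),
      pOf p (fun ω => ((fun i => U i ω), (fun i => X i ω))) (u, x)
        = (∏ i, pOf p (U i) (u i)) * pOf p (fun ω => fun i => X i ω) x)
    (hmin : depC p X = cmi p (X 0) (X 1)
      (fun ω => fun k : {k : Fin (N + 3) // k ≠ 0 ∧ k ≠ 1} => X k ω)) :
    depC p (fun i ω => f i (X i ω) (U i ω))
      ≤ depC p X
        + mi p (fun ω => (X 0 ω, X 1 ω))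
            (fun ω => fun k : {k : Fin (N + 3) // k ≠ 0 ∧ k ≠ 1} => X k ω)
        - mi p (fun ω => (X 0 ω, X 1 ω))
            (fun ω => fun k : {k : Fin (N + 3) // k ≠ 0 ∧ k ≠ 1} => f k (X k ω) (U k ω)) := by
  set A := X 0
  set B := X 1
  set Z := (fun ω => fun k : {k : Fin (N + 3) // k ≠ 0 ∧ k ≠ 1} => X k ω) with hZ
  set Zb := (fun ω => fun k : {k : Fin (N + 3) // k ≠ 0 ∧ k ≠ 1} => f k (X k ω) (U k ω)) with hZb
  have h01 : (0 : Fin (N + 3)) ≠ 1 := by simp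
  have hle : depC p (fun i ω => f i (X i ω) (U i ω)) ≤
      cmi p (fun ω => f 0 (A ω) (U 0 ω)) (fun ω => f 1 (B ω) (U 1 ω)) Zb := by
    apply csInf_le
    · refine ⟨0, ?_⟩
      rintro x ⟨i, j, _, rfl⟩
      exact cmi_nonneg' p hp _ _ _
    · exact ⟨0, 1, h01, rfl⟩
  set Ab := (fun ω => f 0 (A ω) (U 0 ω)) with hAb
  set Bb := (fun ω => f 1 (B ω) (U 1 ω)) with hBb
  have hU : Fac p (fun ω => fun i => U i ω) (fun ω => fun i => X i ω) :=
    ⟨fun u => ∏ i, pOf p (U i) (u i), _, fun u x => hind u x⟩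
  have f0 := fac_one p X U hind 0
  have f1 := fac_one p X U hind 1
  -- independence identities
  have i1 := (f0.map (fun t => (t.1 0, fun k : {k : Fin (N + 3) // k ≠ 0 ∧ k ≠ 1} =>
    f k (t.1 k) (t.2 ⟨k, k.2.1⟩)))).ent_add hp1
  have i2 := (f1.map (fun t => (t.1 1, fun k : {k : Fin (N + 3) // k ≠ 0 ∧ k ≠ 1} =>
    f k (t.1 k) (t.2 ⟨k, k.2.2⟩)))).ent_add hp1
  have i3 := (f0.map (fun t => (t.2 ⟨1, h01.symm⟩, ((t.1 0, t.1 1),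
    fun k : {k : Fin (N + 3) // k ≠ 0 ∧ k ≠ 1} =>
    f k (t.1 k) (t.2 ⟨k, k.2.1⟩))))).ent_add hp1
  have i4 := (f1.map (fun t => ((t.1 0, t.1 1),
    fun k : {k : Fin (N + 3) // k ≠ 0 ∧ k ≠ 1} =>
    f k (t.1 k) (t.2 ⟨k, k.2.2⟩)))).ent_add hp1
  have i5 := (hU.map (fun x => (x 0, fun k : {k : Fin (N + 3) // k ≠ 0 ∧ k ≠ 1} =>
    x k))).ent_add hp1
  have i6 := (hU.map (fun x => (x 1, fun k : {k : Fin (N + 3) // k ≠ 0 ∧ k ≠ 1} =>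
    x k))).ent_add hp1
  have i7 := (hU.map (fun x => ((x 0, x 1), fun k : {k : Fin (N + 3) // k ≠ 0 ∧ k ≠ 1} =>
    x k))).ent_add hp1
  change ent p (fun ω => (U 0 ω, (A ω, Zb ω))) = _ + ent p (fun ω => (A ω, Zb ω)) at i1
  change ent p (fun ω => (U 1 ω, (B ω, Zb ω))) = _ + ent p (fun ω => (B ω, Zb ω)) at i2
  change ent p (fun ω => (U 0 ω, (U 1 ω, ((A ω, B ω), Zb ω)))) =
    _ + ent p (fun ω => (U 1 ω, ((A ω, B ω), Zb ω))) at i3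
  change ent p (fun ω => (U 1 ω, ((A ω, B ω), Zb ω))) =
    _ + ent p (fun ω => ((A ω, B ω), Zb ω)) at i4
  change ent p (fun ω => ((fun i => U i ω), (A ω, Z ω))) =
    _ + ent p (fun ω => (A ω, Z ω)) at i5
  change ent p (fun ω => ((fun i => U i ω), (B ω, Z ω))) =
    _ + ent p (fun ω => (B ω, Z ω)) at i6
  change ent p (fun ω => ((fun i => U i ω), ((A ω, B ω), Z ω))) =
    _ + ent p (fun ω => ((A ω, B ω), Z ω)) at i7
  have eA : ∀ ω ω', U 0 ω = U 0 ω' → A ω = A ω' → Ab ω = Ab ω' := by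
    intro ω ω' h1 h2; simp only [hAb, h1, h2]
  have eB : ∀ ω ω', U 1 ω = U 1 ω' → B ω = B ω' → Bb ω = Bb ω' := by
    intro ω ω' h1 h2; simp only [hBb, h1, h2]
  have eZ : ∀ ω ω', (fun i => U i ω) = (fun i => U i ω') → Z ω = Z ω' → Zb ω = Zb ω' := by
    intro ω ω' h1 h2
    funext k
    have h1' := congrFun h1 k
    have h2' := congrFun h2 k
    simp only [hZ] at h1' h2'
    simp only [hZb, h1', h2']
  have s1 := submod p hp (fun ω => (U 0 ω, (A ω, Zb ω))) (fun ω => ((Ab ω, Bb ω), Zb ω))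
    (fun ω => (U 0 ω, (A ω, (Bb ω, Zb ω)))) (fun ω => (Ab ω, Zb ω))
    (by intro ω ω'; have := eA ω ω'; simp only [Prod.mk.injEq]; tauto)
    (by intro ω ω'; simp only [Prod.mk.injEq]; tauto)
    (by intro ω ω'; have := eA ω ω'; simp only [Prod.mk.injEq]; tauto)
  have s2 := submod p hp (fun ω => (U 1 ω, (B ω, Zb ω))) (fun ω => (U 0 ω, (A ω, (Bb ω, Zb ω))))
    (fun ω => (U 0 ω, (U 1 ω, ((A ω, B ω), Zb ω)))) (fun ω => (Bb ω, Zb ω))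
    (by intro ω ω'; have := eB ω ω'; simp only [Prod.mk.injEq]; tauto)
    (by intro ω ω'; simp only [Prod.mk.injEq]; tauto)
    (by intro ω ω'; have := eB ω ω'; simp only [Prod.mk.injEq]; tauto)
  have d1 := submod p hp (fun ω => ((fun i => U i ω), (A ω, Z ω))) (fun ω => ((A ω, B ω), Zb ω))
    (fun ω => ((fun i => U i ω), ((A ω, B ω), Z ω))) (fun ω => (A ω, Zb ω))
    (by intro ω ω'; have := eZ ω ω'; simp only [Prod.mk.injEq]; tauto)
    (by intro ω ω'; simp only [Prod.mk.injEq]; tauto)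
    (by intro ω ω'; have := eZ ω ω'; simp only [Prod.mk.injEq]; tauto)
  have d2 := submod p hp (fun ω => ((fun i => U i ω), (B ω, Z ω))) (fun ω => ((A ω, B ω), Zb ω))
    (fun ω => ((fun i => U i ω), ((A ω, B ω), Z ω))) (fun ω => (B ω, Zb ω))
    (by intro ω ω'; have := eZ ω ω'; simp only [Prod.mk.injEq]; tauto)
    (by intro ω ω'; simp only [Prod.mk.injEq]; tauto)
    (by intro ω ω'; have := eZ ω ω'; simp only [Prod.mk.injEq]; tauto)
  rw [hmin]
  refine hle.trans ?_
  unfold cmi mi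
  linarith
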